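/- There exists a non-degenerate ranking problem and a merit function M for which the disparate treatment constraints are satisfied by at least one ranking policy, such that no ranking policy π that maximizes the overall utility U(π) among all policies satisfying the disparate treatment constraints is Pareto efficient for the user groups. -/

import Mathlib

open Finset

/-- A ranking problem in a two-sided market: finite nonempty sets of items, intents,
user groups; a partition of the items into item groups; group proportions; per-group
intent distributions; a nonnegative relevance function; and a nonnegative exposure
function on positions with positive total exposure. -/
structure RankingProblem where
  Item : Type
  Intent : Type
  UserGrp : Type
  ItemGrp : Type
  [itemFin : Fintype Item]
  [itemDec : DecidableEq Item]
  [intentFin : Fintype Intent]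
  [userFin : Fintype UserGrp]
  [itemGrpFin : Fintype ItemGrp]
  [itemGrpDec : DecidableEq ItemGrp]
  [itemNe : Nonempty Item]
  [intentNe : Nonempty Intent]
  [userNe : Nonempty UserGrp]
  /-- group proportion of each user group -/
  ρ : UserGrp → ℝ
  ρ_nonneg : ∀ g, 0 ≤ ρ g
  ρ_sum : ∑ g, ρ g = 1
  /-- the item group of each item; this partitions the items, each group being nonempty -/
  grp : Item → ItemGrp
  grp_surj : Function.Surjective grp
  /-- intent distribution of each user group -/
  intentDist : UserGrp → Intent → ℝ
  intentDist_nonneg : ∀ g i, 0 ≤ intentDist g i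
  intentDist_sum : ∀ g, ∑ i, intentDist g i = 1
  /-- relevance of each item to each intent -/
  rel : Item → Intent → ℝ
  rel_nonneg : ∀ d i, 0 ≤ rel d i
  /-- exposure of each position -/
  expo : Fin (Fintype.card Item) → ℝ
  expo_nonneg : ∀ n, 0 ≤ expo n
  expo_sum_pos : 0 < ∑ n, expo n

attribute [instance] RankingProblem.itemFin RankingProblem.itemDec
  RankingProblem.intentFin RankingProblem.userFin RankingProblem.itemGrpFin
  RankingProblem.itemGrpDec RankingProblem.itemNe RankingProblem.intentNe
  RankingProblem.userNe

namespace RankingProblem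

variable (P : RankingProblem)

/-- A ranking is a bijection from items onto positions. -/
abbrev Ranking := P.Item ≃ Fin (Fintype.card P.Item)

/-- The overall intent distribution I_U(i) = Σ_UG ρ_UG · I_UG(i). -/
noncomputable def overallIntent (i : P.Intent) : ℝ := ∑ g, P.ρ g * P.intentDist g i

/-- Utility of a ranking for an intent: U(σ|i) = Σ_d e(σ(d))·r(d,i). -/
noncomputable def intentUtil (σ : P.Ranking) (i : P.Intent) : ℝ :=
  ∑ d, P.expo (σ d) * P.rel d i

/-- A ranking policy: a (finitely supported) probability distribution over rankings. -/
def IsPolicy (π : P.Ranking → ℝ) : Prop := (∀ σ, 0 ≤ π σ) ∧ ∑ σ, π σ = 1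

/-- Utility of a policy for a user group. -/
noncomputable def groupUtil (π : P.Ranking → ℝ) (g : P.UserGrp) : ℝ :=
  ∑ σ, π σ * ∑ i, P.intentDist g i * P.intentUtil σ i

/-- Overall utility of a policy. -/
noncomputable def utility (π : P.Ranking → ℝ) : ℝ := ∑ g, P.ρ g * P.groupUtil π g

/-- Utility of a policy for an item group. -/
noncomputable def itemGroupUtil (π : P.Ranking → ℝ) (dg : P.ItemGrp) : ℝ :=
  ∑ σ, π σ * ∑ i, P.overallIntent i *
    ∑ d ∈ univ.filter (fun d => P.grp d = dg), P.expo (σ d) * P.rel d i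

/-- Average exposure of an item group under a policy. -/
noncomputable def groupExposure (π : P.Ranking → ℝ) (dg : P.ItemGrp) : ℝ :=
  (∑ σ, π σ * ∑ d ∈ univ.filter (fun d => P.grp d = dg), P.expo (σ d)) /
    (univ.filter (fun d => P.grp d = dg)).card

/-- Expected relevance of an item to the whole user population. -/
noncomputable def expRel (d : P.Item) : ℝ := ∑ i, P.overallIntent i * P.rel d i

/-- Non-degeneracy of a ranking problem. -/
def NonDegenerate : Prop :=
  (∀ g, 0 < P.ρ g) ∧ (∀ i, 0 < P.overallIntent i) ∧
    (∀ i, ∃ d, 0 < P.rel d i) ∧ (∀ dg, ∃ d, P.grp d = dg ∧ 0 < P.expRel d)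

/-- The amount of intent covered by a ranking. -/
noncomputable def coverage (σ : P.Ranking) : ℝ :=
  ∑ i ∈ univ.filter (fun i => 0 < P.intentUtil σ i), P.overallIntent i

instance : Nonempty P.Ranking := ⟨Fintype.equivFin P.Item⟩

/-- The maximum amount of intent coverable by any ranking. -/
noncomputable def maxCoverage : ℝ := ⨆ σ : P.Ranking, P.coverage σ

/-- Items are ranked by expected relevance within each item group under π. -/
def RankedByExpRel (π : P.Ranking → ℝ) : Prop :=
  ∀ σ, 0 < π σ → ∀ dm dn, P.grp dm = P.grp dn → P.expRel dn < P.expRel dm →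
    P.expo (σ dn) ≤ P.expo (σ dm)

/-- User fairness of a policy with respect to a concave increasing function f. -/
noncomputable def userFairness (f : ℝ → ℝ) (π : P.Ranking → ℝ) : ℝ :=
  ∑ g, P.ρ g * f (P.groupUtil π g)

/-- Diversity of a single ranking with respect to a concave increasing function g. -/
noncomputable def rankDiversity (gf : ℝ → ℝ) (σ : P.Ranking) : ℝ :=
  ∑ i, P.overallIntent i * gf (P.intentUtil σ i)

/-- Diversity of a policy. -/
noncomputable def diversity (gf : ℝ → ℝ) (π : P.Ranking → ℝ) : ℝ :=
  ∑ σ, π σ * P.rankDiversity gf σ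

/-- π maximizes the overall utility over all ranking policies. -/
def MaxUtil (π : P.Ranking → ℝ) : Prop :=
  P.IsPolicy π ∧ ∀ π', P.IsPolicy π' → P.utility π' ≤ P.utility π

/-- π maximizes user fairness over all ranking policies. -/
def MaxUF (f : ℝ → ℝ) (π : P.Ranking → ℝ) : Prop :=
  P.IsPolicy π ∧ ∀ π', P.IsPolicy π' → P.userFairness f π' ≤ P.userFairness f π

/-- π maximizes diversity over all ranking policies. -/
def MaxDiv (gf : ℝ → ℝ) (π : P.Ranking → ℝ) : Prop :=
  P.IsPolicy π ∧ ∀ π', P.IsPolicy π' → P.diversity gf π' ≤ P.diversity gf π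

/-- π satisfies the disparate treatment constraints with merit function M. -/
def SatDT (M : P.ItemGrp → ℝ) (π : P.Ranking → ℝ) : Prop :=
  ∀ dg1 dg2, P.groupExposure π dg1 / M dg1 = P.groupExposure π dg2 / M dg2

/-- π maximizes overall utility among policies satisfying the disparate treatment
constraints with merit function M. -/
def MaxUtilDT (M : P.ItemGrp → ℝ) (π : P.Ranking → ℝ) : Prop :=
  P.IsPolicy π ∧ P.SatDT M π ∧
    ∀ π', P.IsPolicy π' → P.SatDT M π' → P.utility π' ≤ P.utility π

/-- π dominates π' for the user groups. -/
def DominatesUsers (π π' : P.Ranking → ℝ) : Prop :=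
  (∀ g, P.groupUtil π' g ≤ P.groupUtil π g) ∧ ∃ g, P.groupUtil π' g < P.groupUtil π g

/-- π is Pareto efficient for the user groups. -/
def ParetoUsers (π : P.Ranking → ℝ) : Prop :=
  ¬ ∃ π', P.IsPolicy π' ∧ P.DominatesUsers π' π

/-- σ dominates σ' for the intents. -/
def DominatesIntents (σ σ' : P.Ranking) : Prop :=
  (∀ i, P.intentUtil σ' i ≤ P.intentUtil σ i) ∧ ∃ i, P.intentUtil σ' i < P.intentUtil σ i

/-- σ is Pareto efficient for the intents. -/
def ParetoIntents (σ : P.Ranking) : Prop := ¬ ∃ σ', P.DominatesIntents σ' σ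

end RankingProblem
/-- Two items, one intent, one user group, each item its own group; only the top position
gets exposure and item 0 is twice as relevant as item 1. -/
noncomputable def exProblem : RankingProblem where
  Item := Fin 2
  Intent := Unit
  UserGrp := Unit
  ItemGrp := Fin 2
  ρ := fun _ => 1
  ρ_nonneg := fun _ => zero_le_one
  ρ_sum := by simp
  grp := fun d => d
  grp_surj := fun d => ⟨d, rfl⟩
  intentDist := fun _ _ => 1
  intentDist_nonneg := fun _ _ => zero_le_one
  intentDist_sum := by simp
  rel := fun d _ => if d = 0 then 2 else 1
  rel_nonneg := by intro d _; split_ifs <;> norm_num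
  expo := fun n => if n.val = 0 then 1 else 0
  expo_nonneg := by intro n; split_ifs <;> norm_num
  expo_sum_pos := by
    show 0 < ∑ n : Fin 2, (if n.val = 0 then (1 : ℝ) else 0)
    simp

theorem sum_rankings (f : (Fin 2 ≃ Fin 2) → ℝ) :
    ∑ σ, f σ = f (Equiv.refl _) + f (Equiv.swap 0 1) := by
  have h : (univ : Finset (Fin 2 ≃ Fin 2)) = {Equiv.refl _, Equiv.swap 0 1} := by decide
  rw [h, Finset.sum_pair (by decide)]

/-- The ranking with item 0 on top. -/
def rk0 : Fin 2 ≃ Fin 2 := Equiv.refl _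

/-- The ranking with item 1 on top. -/
def rk1 : Fin 2 ≃ Fin 2 := Equiv.swap 0 1

/-- Choose the first value for index 0 and the second one otherwise. -/
noncomputable def sel (k : Fin 2) (a b : ℝ) : ℝ := if k = 0 then a else b

theorem ex_sum (f : exProblem.Ranking → ℝ) :
    ∑ σ, f σ = f rk0 + f rk1 :=
  sum_rankings f

theorem ex_groupUtil (π : exProblem.Ranking → ℝ) (g : exProblem.UserGrp) :
    exProblem.groupUtil π g
      = π rk0 * 2 + π rk1 := by
  have key : ∀ σ : Fin 2 ≃ Fin 2,
      (∑ i, exProblem.intentDist g i * exProblem.intentUtil σ i)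
        = (if (σ 0).val = 0 then (1 : ℝ) else 0) * 2
          + (if (σ 1).val = 0 then (1 : ℝ) else 0) * 1 := by
    intro σ
    show ∑ i : Unit, (1 : ℝ) * ∑ d : Fin 2,
      (if (σ d).val = 0 then (1 : ℝ) else 0) * (if d = 0 then 2 else 1) = _
    simp [Fin.sum_univ_two]
  unfold RankingProblem.groupUtil
  rw [ex_sum, key, key]
  simp [rk0, rk1]

theorem plain_exposure (π : (Fin 2 ≃ Fin 2) → ℝ) (k : Fin 2) :
    (∑ σ, π σ * ∑ d ∈ univ.filter (fun d : Fin 2 => d = k),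
      (if (σ d).val = 0 then (1 : ℝ) else 0)) / ((univ.filter (fun d : Fin 2 => d = k)).card : ℝ)
      = sel k (π rk0) (π rk1) := by
  have hs : univ.filter (fun d : Fin 2 => d = k) = {k} := by
    ext d
    simp
  rw [sum_rankings, hs, Finset.sum_singleton, Finset.sum_singleton, Finset.card_singleton]
  fin_cases k <;> simp [sel, rk0, rk1]

theorem ex_exposure (π : exProblem.Ranking → ℝ) (k : exProblem.ItemGrp) :
    exProblem.groupExposure π k = sel k (π rk0) (π rk1) :=
  plain_exposure π k

/-- There exist a non-degenerate ranking problem and a merit function with satisfiable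
disparate treatment constraints such that no policy maximizing utility subject to them
is Pareto efficient for the user groups. -/
theorem stmt14 :
    ∃ (P : RankingProblem) (M : P.ItemGrp → ℝ), P.NonDegenerate ∧ (∀ dg, 0 < M dg) ∧
      (∃ π0 : P.Ranking → ℝ, P.IsPolicy π0 ∧ P.SatDT M π0) ∧
      ∀ π : P.Ranking → ℝ, P.MaxUtilDT M π → ¬ P.ParetoUsers π := by
  refine ⟨exProblem, fun _ => 1, ⟨fun _ => ?_, fun _ => ?_, fun _ => ?_, fun k => ?_⟩,
    fun _ => one_pos, ⟨fun _ => 1 / 2, ⟨fun _ => by norm_num, ?_⟩, ?_⟩, ?_⟩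
  · exact one_pos
  · show (0 : ℝ) < ∑ g : Unit, (1 : ℝ) * 1
    simp
  · refine ⟨(0 : Fin 2), ?_⟩
    show (0 : ℝ) < if (0 : Fin 2) = 0 then 2 else 1
    simp
  · refine ⟨k, rfl, ?_⟩
    change Fin 2 at k
    show (0 : ℝ) < ∑ i : Unit, (∑ g : Unit, (1 : ℝ) * 1) * (if k = 0 then 2 else 1)
    split_ifs <;> simp
  · rw [ex_sum]; norm_num
  · intro a b
    have e : ∀ c, exProblem.groupExposure (fun _ => 1 / 2) c = 1 / 2 := by
      intro c
      rw [ex_exposure]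
      simp [sel]
    show exProblem.groupExposure (fun _ => 1 / 2) a / 1 =
      exProblem.groupExposure (fun _ => 1 / 2) b / 1
    rw [e, e]
  · rintro π ⟨⟨_, h1⟩, hDT, _⟩ hP
    have h0 : exProblem.groupExposure π (0 : Fin 2) = π rk0 :=
      (ex_exposure π (0 : Fin 2)).trans (if_pos rfl)
    have h2 : exProblem.groupExposure π (1 : Fin 2) = π rk1 :=
      (ex_exposure π (1 : Fin 2)).trans (if_neg (by decide))
    have h3 : exProblem.groupExposure π (0 : Fin 2) / 1
        = exProblem.groupExposure π (1 : Fin 2) / 1 := hDT (0 : Fin 2) (1 : Fin 2)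
    have h : π rk0 = π rk1 := by
      rw [div_one, div_one] at h3
      exact h0.symm.trans (h3.trans h2)
    rw [ex_sum] at h1
    have hne : rk1 ≠ rk0 := by decide
    let τ : (Fin 2 ≃ Fin 2) → ℝ := fun σ => if σ = rk0 then 1 else 0
    have t0 : τ rk0 = 1 := if_pos rfl
    have t1 : τ rk1 = 0 := if_neg hne
    have lt : ∀ g, exProblem.groupUtil π g < exProblem.groupUtil τ g := by
      intro g
      have u1 := ex_groupUtil π g
      have u2 : exProblem.groupUtil τ g = τ rk0 * 2 + τ rk1 := ex_groupUtil τ g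
      rw [t0, t1] at u2
      linarith
    refine hP ⟨τ, ⟨fun σ => ?_, ?_⟩, fun g => (lt g).le, (), lt ()⟩
    · have : ∀ σ : Fin 2 ≃ Fin 2, 0 ≤ τ σ := by
        intro σ
        simp only [τ]
        split_ifs <;> norm_num
      exact this σ
    · have u3 : ∑ σ, τ σ = τ rk0 + τ rk1 := sum_rankings τ
      rw [t0, t1, add_zero] at u3
      exact u3
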